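/- For every k with 0 ≤ k ≤ binomial(n,2), the set of all Dyck paths of order n with area equal to k is a maximal antichain in the poset of Dyck paths of order n ordered by inclusion. -/

import Mathlib

structure DyckPath (n : ℕ) where
  toList : List Bool
  length_eq : toList.length = 2 * n
  count_true : toList.count true = n
  diag : ∀ k ≤ toList.length, (toList.take k).count false ≤ (toList.take k).count true

instance (n : ℕ) : PartialOrder (DyckPath n) where
  le d₁ d₂ := ∀ k, (d₁.toList.take k).count true ≤ (d₂.toList.take k).count true
  le_refl _ _ := le_rfl
  le_trans _ _ _ h₁ h₂ k := (h₁ k).trans (h₂ k)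
  le_antisymm a b h₁ h₂ := by
    have hc : ∀ k, (a.toList.take k).count true = (b.toList.take k).count true :=
      fun k => le_antisymm (h₁ k) (h₂ k)
    have hlen : a.toList.length = b.toList.length := by rw [a.length_eq, b.length_eq]
    have hl : a.toList = b.toList := by
      apply List.ext_getElem hlen
      intro i hi hib
      have h1 := hc i
      have h2 := hc (i + 1)
      rw [List.take_succ, List.take_succ, List.count_append, List.count_append, h1] at h2
      have h2' : (a.toList[i]?.toList).count true = (b.toList[i]?.toList).count true := by omega
      rw [List.getElem?_eq_getElem hi, List.getElem?_eq_getElem hib] at h2'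
      simp only [Option.toList_some] at h2'
      cases ha : a.toList[i] <;> cases hb : b.toList[i] <;> simp_all [List.count_cons]
    cases a; cases b; cases hl; rfl

/-- The area of a Dyck path: the number of complete lattice cells lying
between the path and the line `y = x`. -/
def pathArea (l : List Bool) : ℕ :=
  ∑ i ∈ Finset.range l.length,
    if l.getD i true = false then (l.take i).count true - ((l.take i).count false + 1) else 0

structure IsHt (n : ℕ) (h : ℕ → ℕ) : Prop where
  zero : h 0 = 0
  mono : ∀ i, h i ≤ h (i+1)
  step : ∀ i, h (i+1) ≤ h i + 1
  tail : ∀ i, 2 * n ≤ i → h i = n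
  diag : ∀ i, i ≤ 2 * n → i ≤ 2 * h i

def ht (l : List Bool) (i : ℕ) : ℕ := (l.take i).count true

lemma take_count_add (l : List Bool) (i : ℕ) (hi : i ≤ l.length) :
    (l.take i).count false + (l.take i).count true = i := by
  have := List.count_false_add_count_true (l.take i)
  rw [this, List.length_take, min_eq_left hi]

lemma count_take_succ (l : List Bool) (i : ℕ) (hi : i < l.length) (b : Bool) :
    (l.take (i+1)).count b = (l.take i).count b + (if l[i] = b then 1 else 0) := by
  rw [List.take_succ, List.count_append, List.getElem?_eq_getElem hi]
  simp [List.count_cons]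

lemma isHt_ht {n : ℕ} (d : DyckPath n) : IsHt n (ht d.toList) := by
  have hs : ∀ i, ht d.toList i ≤ ht d.toList (i+1) ∧ ht d.toList (i+1) ≤ ht d.toList i + 1 := by
    intro i
    unfold ht
    by_cases hi : i < d.toList.length
    · rw [count_take_succ _ _ hi]
      split_ifs <;> omega
    · rw [List.take_of_length_le (by omega), List.take_of_length_le (by omega)]
      omega
  refine ⟨by simp [ht], fun i => (hs i).1, fun i => (hs i).2, ?_, ?_⟩
  · intro i hi
    unfold ht
    rw [List.take_of_length_le (by rw [d.length_eq]; exact hi), d.count_true]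
  · intro i hi
    have h1 := d.diag i (by rw [d.length_eq]; exact hi)
    have h2 := take_count_add d.toList i (by rw [d.length_eq]; exact hi)
    unfold ht
    omega

def htList (n : ℕ) (h : ℕ → ℕ) : List Bool :=
  List.ofFn (fun i : Fin (2 * n) => decide (h i < h (i+1)))

lemma ht_htList {n : ℕ} {h : ℕ → ℕ} (H : IsHt n h) : ∀ i, ht (htList n h) i = h i := by
  have hlen : (htList n h).length = 2 * n := by simp [htList]
  have key : ∀ i, i ≤ 2 * n → ht (htList n h) i = h i := by
    intro i
    induction i with
    | zero => intro _; simp [ht, H.zero]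
    | succ i ih =>
      intro hi
      have h1 := ih (by omega)
      have h2 := H.mono i
      have h3 := H.step i
      unfold ht at *
      rw [count_take_succ _ _ (by omega), h1]
      simp only [htList, List.getElem_ofFn, decide_eq_true_eq]
      split_ifs <;> omega
  intro i
  by_cases hi : i ≤ 2 * n
  · exact key i hi
  · have := key (2 * n) le_rfl
    rw [H.tail i (by omega)]
    rw [H.tail (2*n) le_rfl] at this
    refine Eq.trans ?_ this
    unfold ht
    rw [List.take_of_length_le (by omega), List.take_of_length_le (by omega)]

lemma exists_path {n : ℕ} {h : ℕ → ℕ} (H : IsHt n h) : ∃ d : DyckPath n, ht d.toList = h := by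
  have hlen : (htList n h).length = 2 * n := by simp [htList]
  refine ⟨⟨htList n h, hlen, ?_, ?_⟩, funext (ht_htList H)⟩
  · have := ht_htList H (2 * n)
    unfold ht at this
    rwa [List.take_of_length_le (by omega), H.tail _ le_rfl] at this
  · intro k hk
    have h1 := take_count_add _ k hk
    have h2 := ht_htList H k
    have h3 := H.diag k (by omega)
    unfold ht at h2
    omega

def hsum (n : ℕ) (h : ℕ → ℕ) : ℕ := ∑ i ∈ Finset.range (2 * n), h i

lemma area_aux (l : List Bool)
    (hd : ∀ k ≤ l.length, (l.take k).count false ≤ (l.take k).count true) :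
    ∀ m ≤ l.length,
    2 * (∑ i ∈ Finset.range m, ((ht l i : ℕ) : ℤ)) =
    2 * (((∑ i ∈ Finset.range m, if l.getD i true = false then
      (l.take i).count true - ((l.take i).count false + 1) else 0 : ℕ)) : ℤ)
    + ((l.take m).count true : ℤ) * ((l.take m).count true - 1)
    + ((l.take m).count false : ℤ) * ((l.take m).count false + 1) := by
  intro m
  induction m with
  | zero => simp
  | succ m ih =>
    intro hm
    have h1 := ih (by omega)
    have h2 := hd (m+1) hm
    have hm' : m < l.length := by omega
    rw [Finset.sum_range_succ, Finset.sum_range_succ, mul_add, h1]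
    rw [count_take_succ l m hm', count_take_succ l m hm'] at *
    rw [List.getD_eq_getElem _ _ hm']
    unfold ht
    cases hb : l[m]
    · simp only [hb] at h2
      simp at h2 ⊢
      rw [Nat.cast_sub (by omega)]
      push_cast
      ring
    · simp
      ring

lemma hsum_eq {n : ℕ} (d : DyckPath n) : hsum n (ht d.toList) = pathArea d.toList + n * n := by
  have h := area_aux d.toList d.diag _ le_rfl
  have h2 := take_count_add d.toList _ le_rfl
  rw [List.take_length, d.count_true, d.length_eq] at h2
  rw [List.take_length, d.count_true, show d.toList.count false = n by omega] at h
  unfold hsum pathArea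
  rw [← d.length_eq]
  zify
  push_cast at h ⊢
  linarith

lemma one_step {n : ℕ} {d e : ℕ → ℕ} (D : IsHt n d) (E : IsHt n e) (hle : ∀ i, d i ≤ e i)
    (hlt : hsum n d < hsum n e) :
    ∃ f, IsHt n f ∧ (∀ i, d i ≤ f i) ∧ (∀ i, f i ≤ e i) ∧ hsum n f = hsum n d + 1 := by
  obtain ⟨i0, hi0, hi0'⟩ := Finset.exists_lt_of_sum_lt hlt
  obtain ⟨i, hi, hmin⟩ := Finset.exists_min_image
    ((Finset.range (2 * n)).filter (fun i => d i < e i)) (fun i => (2 * d i : ℤ) - i)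
    ⟨i0, by simp only [Finset.mem_filter]; exact ⟨hi0, hi0'⟩⟩
  simp only [Finset.mem_filter, Finset.mem_range] at hi hmin
  obtain ⟨hi, hde⟩ := hi
  have hi1 : i ≠ 0 := by
    rintro rfl
    rw [D.zero, E.zero] at hde; omega
  obtain ⟨j, rfl⟩ := Nat.exists_eq_succ_of_ne_zero hi1
  simp only [Nat.succ_eq_add_one] at *
  have hnext : d (j+1+1) = d (j+1) + 1 := by
    by_contra hc
    have a1 := D.mono (j+1)
    have a2 := D.step (j+1)
    have a3 := E.mono (j+1)
    by_cases hj : j + 1 + 1 < 2 * n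
    · have := hmin (j+1+1) ⟨hj, by omega⟩
      push_cast at this
      omega
    · have := D.tail (j+1+1) (by omega)
      have := E.tail (j+1+1) (by omega)
      omega
  have hprev : d (j+1) = d j := by
    by_contra hc
    have a1 := D.mono j
    have a2 := D.step j
    have a3 := E.step j
    have := hmin j ⟨by omega, by omega⟩
    push_cast at this
    omega
  have hval : ∀ i, Function.update d (j+1) (d (j+1) + 1) i = if i = j+1 then d (j+1) + 1 else d i := by
    intro i; simp [Function.update_apply]
  refine ⟨Function.update d (j+1) (d (j+1) + 1), ⟨?_, ?_, ?_, ?_, ?_⟩, ?_, ?_, ?_⟩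
  · rw [hval]; simp [D.zero]
  · intro i
    rw [hval, hval]
    have := D.mono i
    split_ifs with h1 h2 h2
    · omega
    · subst h1; omega
    · obtain rfl : i = j := by omega
      omega
    · exact this
  · intro i
    rw [hval, hval]
    have := D.step i
    split_ifs with h1 h2 h2
    · omega
    · obtain rfl : i = j := by omega
      omega
    · subst h2; omega
    · exact this
  · intro i hi'
    rw [hval, if_neg (by omega)]; exact D.tail i hi'
  · intro i hi'
    rw [hval]
    have := D.diag i hi'
    split_ifs with h1
    · subst h1; omega
    · exact this
  · intro i
    rw [hval]
    split_ifs with h1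
    · subst h1; omega
    · exact le_rfl
  · intro i
    rw [hval]
    split_ifs with h1
    · subst h1; omega
    · exact hle i
  · unfold hsum
    have hm : j + 1 ∈ Finset.range (2 * n) := Finset.mem_range.2 hi
    rw [Finset.sum_update_of_mem hm, ← Finset.add_sum_erase _ _ hm, Finset.sdiff_singleton_eq_erase]
    omega

lemma interp {n : ℕ} {e : ℕ → ℕ} (E : IsHt n e) (k : ℕ) (hk : k ≤ hsum n e) :
    ∀ m (d : ℕ → ℕ), IsHt n d → (∀ i, d i ≤ e i) → hsum n d + m = k →
    ∃ f, IsHt n f ∧ (∀ i, d i ≤ f i) ∧ (∀ i, f i ≤ e i) ∧ hsum n f = k := by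
  intro m
  induction m with
  | zero => intro d D hle h; exact ⟨d, D, fun _ => le_rfl, hle, h⟩
  | succ m ih =>
    intro d D hle h
    obtain ⟨f, F, h1, h2, h3⟩ := one_step D E hle (by omega)
    obtain ⟨g, G, h4, h5, h6⟩ := ih f F h2 (by omega)
    exact ⟨g, G, fun i => (h1 i).trans (h4 i), h5, h6⟩

lemma isHt_top (n : ℕ) : IsHt n (fun i => min i n) := by
  constructor <;> intros <;> (try dsimp only) <;> omega

lemma isHt_bot (n : ℕ) : IsHt n (fun i => min ((i+1)/2) n) := by
  constructor <;> intros <;> (try dsimp only) <;> omega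

lemma IsHt.le_top {n : ℕ} {h : ℕ → ℕ} (H : IsHt n h) (i : ℕ) : h i ≤ min i n := by
  have h1 : ∀ i, h i ≤ i := by
    intro i
    induction i with
    | zero => rw [H.zero]
    | succ i ih => have := H.step i; omega
  have hm : Monotone h := monotone_nat_of_le_succ H.mono
  have h2 := hm (Nat.le_add_right i (2 * n))
  rw [H.tail (i + 2 * n) (by omega)] at h2
  exact le_min (h1 i) h2

lemma IsHt.bot_le {n : ℕ} {h : ℕ → ℕ} (H : IsHt n h) (i : ℕ) : min ((i+1)/2) n ≤ h i := by
  by_cases hi : i ≤ 2 * n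
  · have := H.diag i hi
    omega
  · rw [H.tail i (by omega)]; omega

lemma hsum_bot (n : ℕ) : hsum n (fun i => min ((i+1)/2) n) = n * n := by
  have : ∀ m ≤ n, ∑ i ∈ Finset.range (2 * m), min ((i+1)/2) n = m * m := by
    intro m
    induction m with
    | zero => simp
    | succ m ih =>
      intro hm
      rw [show 2 * (m+1) = 2 * m + 1 + 1 by ring, Finset.sum_range_succ, Finset.sum_range_succ,
        ih (by omega), show min ((2 * m + 1)/2) n = m by omega,
        show min ((2 * m + 1 + 1)/2) n = m + 1 by omega]
      ring
  exact this n le_rfl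

lemma hsum_top (n : ℕ) : hsum n (fun i => min i n) = n.choose 2 + n * n := by
  unfold hsum
  rw [two_mul, Finset.sum_range_add]
  congr 1
  · rw [Nat.choose_two_right, ← Finset.sum_range_id]
    refine Finset.sum_congr rfl fun i hi => ?_
    exact min_eq_left (Finset.mem_range.1 hi).le
  · simp

/-- For every `k` with `0 ≤ k ≤ binomial n 2`, the set of all Dyck paths of
order `n` with area `k` is a maximal antichain in the poset of Dyck paths of
order `n` ordered by inclusion: it is an antichain, and it is not properly
contained in any other antichain. -/
theorem area_level_is_maximal_antichain (n k : ℕ) (hk : k ≤ n.choose 2) :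
    IsAntichain (· ≤ ·) {d : DyckPath n | pathArea d.toList = k} ∧
    ∀ t : Set (DyckPath n), IsAntichain (· ≤ ·) t →
      {d : DyckPath n | pathArea d.toList = k} ⊆ t →
      t = {d : DyckPath n | pathArea d.toList = k} := by
  constructor
  · intro a ha b hb hab hle
    apply hab
    have h1 := hsum_eq a
    have h2 := hsum_eq b
    simp only [Set.mem_setOf_eq] at ha hb
    have hle' : ∀ i, ht a.toList i ≤ ht b.toList i := hle
    have heq : hsum n (ht a.toList) = hsum n (ht b.toList) := by omega
    have h3 := (Finset.sum_eq_sum_iff_of_le (fun i _ => hle' i)).1 heq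
    apply le_antisymm hle
    intro i
    by_cases hi : i < 2 * n
    · exact (h3 i (Finset.mem_range.2 hi)).ge
    · have h4 := (isHt_ht a).tail i (by omega)
      have h5 := (isHt_ht b).tail i (by omega)
      unfold ht at h4 h5
      omega
  · intro t ht' hsub
    refine Set.Subset.antisymm ?_ hsub
    intro d hd
    have hd1 := hsum_eq d
    have D := isHt_ht d
    rcases le_total (pathArea d.toList) k with hc | hc
    · obtain ⟨f, F, h1, h2, h3⟩ := interp (isHt_top n) (k + n * n) (by rw [hsum_top]; omega)
        (k - pathArea d.toList) _ D D.le_top (by omega)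
      obtain ⟨e, rfl⟩ := exists_path F
      have he := hsum_eq e
      have hek : pathArea e.toList = k := by omega
      have hle : d ≤ e := h1
      rw [ht'.eq hd (hsub hek) hle]
      exact hek
    · obtain ⟨f, F, h1, h2, h3⟩ := interp D (k + n * n) (by omega)
        k _ (isHt_bot n) D.bot_le (by rw [hsum_bot]; omega)
      obtain ⟨e, rfl⟩ := exists_path F
      have he := hsum_eq e
      have hek : pathArea e.toList = k := by omega
      have hle : e ≤ d := h2
      rw [← ht'.eq (hsub hek) hd hle]
      exact hek
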